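/- arXiv:2505.07224 — 6 statements merged into one kernel-verified Lean document; each statement's English description precedes it below -/
import Mathlib

section
/- Let A, B, Γ, E, Δ be real constants and define the symmetric biquadratic function K(x,y) = A x²y² + B(x²y + x y²) + Γ(x² + y²) + E x y + Δ(x + y). For any real p with A p² + B p + Γ ≠ 0, set f(p) = −(B p² + E p + Δ)/(A p² + B p + Γ). Then for every real q, K(p, −q + f(p)) = K(q, p); that is, the McMillan form map T(q,p) = (p, −q + f(p)) exactly preserves K wherever the denominator A p² + B p + Γ is nonzero. -/
/-- Suris case (I), 'if' direction: the McMillan form map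
`T(q,p) = (p, -q + f(p))` with `f(p) = -(B p² + E p + Δ)/(A p² + B p + Γ)`
exactly preserves the symmetric biquadratic
`K(x,y) = A x²y² + B(x²y + x y²) + Γ(x² + y²) + E x y + Δ(x + y)`
wherever the denominator is nonzero. -/
theorem mcmillan_biquadratic_invariant
    (A B Γ E Δ : ℝ)
    (K : ℝ → ℝ → ℝ)
    (hK : ∀ x y : ℝ, K x y =
      A * x ^ 2 * y ^ 2 + B * (x ^ 2 * y + x * y ^ 2) + Γ * (x ^ 2 + y ^ 2)
        + E * (x * y) + Δ * (x + y))
    (p : ℝ) (hp : A * p ^ 2 + B * p + Γ ≠ 0)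
    (f : ℝ → ℝ)
    (hf : f p = -(B * p ^ 2 + E * p + Δ) / (A * p ^ 2 + B * p + Γ)) :
    ∀ q : ℝ, K p (-q + f p) = K q p := by
  intro q
  have h : f p * (A * p ^ 2 + B * p + Γ) = -(B * p ^ 2 + E * p + Δ) := by
    rw [hf, div_mul_cancel₀ _ hp]
  rw [hK, hK]
  linear_combination (f p - 2 * q) * h
end

section
/- Let A, B, Γ, Δ, E be real constants and α ≠ 0 a real number. Define K(x,y) = A e^{α(x+y)} + B(e^{αx} + e^{αy}) + Γ(e^{α(x−y)} + e^{−α(x−y)}) + Δ(e^{−αx} + e^{−αy}) + E e^{−α(x+y)}. Suppose p ∈ ℝ is such that N(p) = Γ e^{2αp} + Δ e^{αp} + E > 0 and D(p) = A e^{2αp} + B e^{αp} + Γ > 0, and set f(p) = (1/α)·log(N(p)/D(p)). Then for every real q, K(p, −q + f(p)) = K(q, p); that is, the McMillan form map T(q,p) = (p, −q + f(p)) exactly preserves K at all such p. -/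
open Real

/-- Suris case (II), 'if' direction: the McMillan form map
`T(q,p) = (p, -q + f(p))` with `f(p) = (1/α) log(N(p)/D(p))`,
`N(p) = Γ e^{2αp} + Δ e^{αp} + E`, `D(p) = A e^{2αp} + B e^{αp} + Γ`,
exactly preserves the exponential invariant `K` at all `p` where
`N(p) > 0` and `D(p) > 0`. -/
theorem mcmillan_exponential_invariant
    (A B Γ Δ E α : ℝ) (hα : α ≠ 0)
    (K : ℝ → ℝ → ℝ)
    (hK : ∀ x y : ℝ, K x y =
      A * Real.exp (α * (x + y)) + B * (Real.exp (α * x) + Real.exp (α * y))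
        + Γ * (Real.exp (α * (x - y)) + Real.exp (-(α * (x - y))))
        + Δ * (Real.exp (-(α * x)) + Real.exp (-(α * y)))
        + E * Real.exp (-(α * (x + y))))
    (p : ℝ)
    (hN : Γ * Real.exp (2 * α * p) + Δ * Real.exp (α * p) + E > 0)
    (hD : A * Real.exp (2 * α * p) + B * Real.exp (α * p) + Γ > 0)
    (f : ℝ → ℝ)
    (hf : f p = (1 / α) * Real.log
      ((Γ * Real.exp (2 * α * p) + Δ * Real.exp (α * p) + E) /
       (A * Real.exp (2 * α * p) + B * Real.exp (α * p) + Γ))) :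
    ∀ q : ℝ, K p (-q + f p) = K q p := by
  intro q
  have h2 : Real.exp (2 * α * p) = Real.exp (α * p) ^ 2 := by
    rw [← Real.exp_nat_mul]; congr 1; push_cast; ring
  have hY : Real.exp (α * (-q + f p)) = (Real.exp (α * q))⁻¹ *
      ((Γ * Real.exp (2 * α * p) + Δ * Real.exp (α * p) + E) /
       (A * Real.exp (2 * α * p) + B * Real.exp (α * p) + Γ)) := by
    have h : α * (-q + f p) = -(α * q) + Real.log
      ((Γ * Real.exp (2 * α * p) + Δ * Real.exp (α * p) + E) /
       (A * Real.exp (2 * α * p) + B * Real.exp (α * p) + Γ)) := by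
      rw [hf]; field_simp
    rw [h, Real.exp_add, Real.exp_log (div_pos hN hD), Real.exp_neg]
  have key : ∀ x y : ℝ, K x y =
      A * (Real.exp (α * x) * Real.exp (α * y)) + B * (Real.exp (α * x) + Real.exp (α * y))
        + Γ * (Real.exp (α * x) / Real.exp (α * y) + Real.exp (α * y) / Real.exp (α * x))
        + Δ * ((Real.exp (α * x))⁻¹ + (Real.exp (α * y))⁻¹)
        + E * (Real.exp (α * x) * Real.exp (α * y))⁻¹ := by
    intro x y
    rw [hK, ← Real.exp_add, ← Real.exp_sub, ← Real.exp_sub, ← Real.exp_neg, ← Real.exp_neg,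
      ← Real.exp_neg]
    ring_nf
  have reg : ∀ P Y : ℝ, P ≠ 0 → Y ≠ 0 → A * (P * Y) + B * (P + Y) + Γ * (P / Y + Y / P)
      + Δ * (P⁻¹ + Y⁻¹) + E * (P * Y)⁻¹ =
      (Y * (A * P ^ 2 + B * P + Γ) + (Γ * P ^ 2 + Δ * P + E) * Y⁻¹) / P + B * P + Δ / P := by
    intro P Y hP hY
    field_simp
    ring
  have hP := Real.exp_ne_zero (α * p)
  have hQ := Real.exp_ne_zero (α * q)
  have hsym : K q p = K p q := by rw [key, key]; ring
  rw [hsym, key, key, reg _ _ hP (Real.exp_ne_zero _), reg _ _ hP hQ, hY]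
  rw [h2] at hN hD ⊢
  generalize Γ * Real.exp (α * p) ^ 2 + Δ * Real.exp (α * p) + E = N at *
  generalize A * Real.exp (α * p) ^ 2 + B * Real.exp (α * p) + Γ = D at *
  have hN' := hN.ne'
  have hD' := hD.ne'
  congr 3
  field_simp
  ring
end

section
/- Let a and β be real parameters. Define K_II(p,q) = −a·sinh(p)·sinh(q) + 2β·(sinh(p+q) − sinh(p) − sinh(q)) + 2·(2·cosh(p)·cosh(q) − cosh(p) − cosh(q)), and for real p such that both N(p) = (1 + a/4)e^{2p} − (1−β)e^{p} + (1 − β − a/4) and D(p) = (1 + β − a/4)e^{2p} − (1+β)e^{p} + (1 + a/4) are positive, define f_II(p) = log(N(p)/D(p)). Then for every real q, K_II(p, −q + f_II(p)) = K_II(q, p); i.e., the Suris exponential map T(q,p) = (p, −q + f_II(p)) exactly preserves K_II. -/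
/-- The Suris exponential map `T(q,p) = (p, -q + f_II(p))` exactly preserves
`K_II(p,q) = -a sinh p sinh q + 2β (sinh(p+q) - sinh p - sinh q)
+ 2 (2 cosh p cosh q - cosh p - cosh q)`, wherever the numerator and
denominator defining `f_II` are positive. -/
theorem suris_exponential_invariant
    (a β : ℝ)
    (K : ℝ → ℝ → ℝ)
    (hK : ∀ p q : ℝ, K p q =
      -a * Real.sinh p * Real.sinh q
        + 2 * β * (Real.sinh (p + q) - Real.sinh p - Real.sinh q)
        + 2 * (2 * Real.cosh p * Real.cosh q - Real.cosh p - Real.cosh q))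
    (p : ℝ)
    (hN : (1 + a / 4) * Real.exp (2 * p) - (1 - β) * Real.exp p
            + (1 - β - a / 4) > 0)
    (hD : (1 + β - a / 4) * Real.exp (2 * p) - (1 + β) * Real.exp p
            + (1 + a / 4) > 0)
    (f : ℝ → ℝ)
    (hf : f p = Real.log
      (((1 + a / 4) * Real.exp (2 * p) - (1 - β) * Real.exp p
          + (1 - β - a / 4)) /
       ((1 + β - a / 4) * Real.exp (2 * p) - (1 + β) * Real.exp p
          + (1 + a / 4)))) :
    ∀ q : ℝ, K p (-q + f p) = K q p := by
  intro q
  have hx := Real.exp_pos p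
  have key : ∀ r : ℝ, Real.exp p * K p r =
      ((1 + β - a / 4) * Real.exp (2 * p) - (1 + β) * Real.exp p + (1 + a / 4)) * Real.exp r
      + ((1 + a / 4) * Real.exp (2 * p) - (1 - β) * Real.exp p + (1 - β - a / 4)) * Real.exp (-r)
      + Real.exp p * (-2 * β * Real.sinh p - 2 * Real.cosh p) := by
    intro r
    have h2 : Real.exp (2 * p) = Real.exp p * Real.exp p := by
      rw [← Real.exp_add]; ring_nf
    have h3 : Real.exp p * Real.exp (-p) = 1 := by
      rw [← Real.exp_add]; simp
    rw [hK, Real.sinh_add, h2]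
    simp only [Real.sinh_eq, Real.cosh_eq]
    linear_combination (Real.exp r * (a / 4 + 1) + Real.exp (-r) * (1 - β - a / 4)) * h3
  have hsymm : K q p = K p q := by
    rw [hK, hK, add_comm q p]; ring
  rw [hsymm]
  apply mul_left_cancel₀ hx.ne'
  rw [key, key, hf]
  generalize (1 + a / 4) * Real.exp (2 * p) - (1 - β) * Real.exp p + (1 - β - a / 4) = N at *
  generalize (1 + β - a / 4) * Real.exp (2 * p) - (1 + β) * Real.exp p + (1 + a / 4) = D at *
  have e1 : Real.exp (-q + Real.log (N / D)) = Real.exp (-q) * (N / D) := by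
    rw [Real.exp_add, Real.exp_log (div_pos hN hD)]
  have e2 : Real.exp (-(-q + Real.log (N / D))) = Real.exp q * (D / N) := by
    rw [neg_add, neg_neg, Real.exp_add, Real.exp_neg, Real.exp_log (div_pos hN hD), inv_div]
  rw [e1, e2]
  have hN' := hN.ne'
  have hD' := hD.ne'
  field_simp
  ring
end

section
/- Let Λ₁, Λ₂, Λ₃, ψ, φ be real constants and ω ≠ 0 a real number. Define K(x,y) = Λ₁(cos(ωx − ψ) + cos(ωy − ψ)) + Λ₂·cos(ω(x+y) − φ) + Λ₃·cos(ω(x−y)), and for p ∈ ℝ define the complex number Z(p) = Λ₁ e^{−iψ} + Λ₂ e^{i(ωp − φ)} + Λ₃ e^{−iωp}. If Z(p) ≠ 0 and q, q′ are real numbers satisfying e^{iω(q + q′)} = conj(Z(p))/Z(p), then K(p, q′) = K(q, p); that is, the map (q,p) ↦ (p, q′) with q′ = −q + f(p), where ω f(p) ≡ −2·arg Z(p) (mod 2π), exactly preserves K. -/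
open Complex

/-- Suris case (III), 'if' direction: with
`Z(p) = Λ₁ e^{-iψ} + Λ₂ e^{i(ωp - φ)} + Λ₃ e^{-iωp}`, if `Z(p) ≠ 0` and
`e^{iω(q + q′)} = conj(Z(p))/Z(p)`, then the trigonometric invariant
`K(x,y) = Λ₁(cos(ωx - ψ) + cos(ωy - ψ)) + Λ₂ cos(ω(x+y) - φ) + Λ₃ cos(ω(x-y))`
satisfies `K(p, q′) = K(q, p)`. -/
theorem mcmillan_trigonometric_invariant
    (Λ₁ Λ₂ Λ₃ ψ φ ω : ℝ) (hω : ω ≠ 0)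
    (K : ℝ → ℝ → ℝ)
    (hK : ∀ x y : ℝ, K x y =
      Λ₁ * (Real.cos (ω * x - ψ) + Real.cos (ω * y - ψ))
        + Λ₂ * Real.cos (ω * (x + y) - φ)
        + Λ₃ * Real.cos (ω * (x - y)))
    (Z : ℝ → ℂ)
    (hZdef : ∀ p : ℝ, Z p =
      (Λ₁ : ℂ) * Complex.exp (-(ψ : ℂ) * Complex.I)
        + (Λ₂ : ℂ) * Complex.exp (((ω * p - φ : ℝ) : ℂ) * Complex.I)
        + (Λ₃ : ℂ) * Complex.exp (-((ω * p : ℝ) : ℂ) * Complex.I))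
    (p q q' : ℝ)
    (hZ : Z p ≠ 0)
    (hqq' : Complex.exp (((ω * (q + q') : ℝ) : ℂ) * Complex.I)
      = (starRingEnd ℂ) (Z p) / Z p) :
    K p q' = K q p := by
  have key : ∀ x : ℝ, (Complex.exp (((ω * x : ℝ) : ℂ) * Complex.I) * Z p).re
      = Λ₁ * Real.cos (ω * x - ψ) + Λ₂ * Real.cos (ω * (x + p) - φ)
        + Λ₃ * Real.cos (ω * (x - p)) := by
    intro x
    have h1 : Complex.exp (((ω * x : ℝ) : ℂ) * Complex.I) * Z p
        = (Λ₁ : ℂ) * Complex.exp (((ω * x - ψ : ℝ) : ℂ) * Complex.I)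
        + (Λ₂ : ℂ) * Complex.exp (((ω * (x + p) - φ : ℝ) : ℂ) * Complex.I)
        + (Λ₃ : ℂ) * Complex.exp (((ω * (x - p) : ℝ) : ℂ) * Complex.I) := by
      rw [hZdef, mul_add, mul_add, mul_left_comm, mul_left_comm _ (Λ₂ : ℂ),
        mul_left_comm _ (Λ₃ : ℂ), ← Complex.exp_add, ← Complex.exp_add, ← Complex.exp_add]
      congr 3
      · congr 2
        push_cast; ring
      · congr 2
        push_cast; ring
      · push_cast; ring
    rw [h1, Complex.add_re, Complex.add_re, Complex.re_ofReal_mul, Complex.re_ofReal_mul,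
      Complex.re_ofReal_mul, Complex.exp_ofReal_mul_I_re, Complex.exp_ofReal_mul_I_re,
      Complex.exp_ofReal_mul_I_re]
  have h2 : Complex.exp (((ω * q' : ℝ) : ℂ) * Complex.I) * Z p
      = (starRingEnd ℂ) (Complex.exp (((ω * q : ℝ) : ℂ) * Complex.I) * Z p) := by
    rw [eq_div_iff hZ] at hqq'
    rw [map_mul, ← hqq', ← Complex.exp_conj, ← mul_assoc, ← Complex.exp_add, map_mul,
      Complex.conj_ofReal, Complex.conj_I]
    congr 2
    push_cast; ring
  have h3 := congrArg Complex.re h2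
  rw [Complex.conj_re, key, key] at h3
  rw [hK, hK]
  have h4 : Real.cos (ω * (p - q')) = Real.cos (ω * (q' - p)) := by
    rw [← Real.cos_neg]; congr 1; ring
  rw [h4, add_comm p q']
  linarith
end

section
/- Let a and β be real numbers and let f_II(p) = log[ ((1 + a/4)e^{2p} − (1−β)e^{p} + (1 − β − a/4)) / ((1 + β − a/4)e^{2p} − (1+β)e^{p} + (1 + a/4)) ], whose numerator and denominator both equal 1 at p = 0 so that f_II is defined and smooth in a neighborhood of p = 0 with f_II(0) = 0. Then as p → 0, f_II(p) = a·p − (a+1)·β·p² + ((a+1)·β² − a·(10 − a²)/12)·p³ + O(p⁴). -/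
open Asymptotics Filter

lemma aux_poly (g : ℝ → ℝ) (hg : Continuous g) :
    (fun p : ℝ => p ^ 4 * g p) =O[nhds (0 : ℝ)] fun p : ℝ => p ^ 4 := by
  have h : g =O[nhds (0 : ℝ)] fun _ : ℝ => (1 : ℝ) := (hg.tendsto 0).isBigO_one ℝ
  simpa using (isBigO_refl (fun p : ℝ => p ^ 4) (nhds (0 : ℝ))).mul h

lemma aux_exp :
    (fun x : ℝ => Real.exp x - (1 + x + x ^ 2 / 2 + x ^ 3 / 6)) =O[nhds (0 : ℝ)]
      fun x : ℝ => x ^ 4 := by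
  refine IsBigO.of_bound 1 ?_
  filter_upwards [Metric.ball_mem_nhds (0 : ℝ) one_pos] with x hx
  have hx1 : |x| ≤ 1 := by
    have := Metric.mem_ball.1 hx
    rw [Real.dist_eq, sub_zero] at this
    exact this.le
  have h := Real.exp_bound hx1 (n := 4) (by norm_num)
  simp only [Finset.sum_range_succ, Finset.sum_range_zero, Nat.factorial] at h
  norm_num at h
  rw [Real.norm_eq_abs, Real.norm_eq_abs, abs_pow, one_mul]
  have h0 : 0 ≤ |x| ^ 4 := by positivity
  linarith

lemma aux_exp_comp (P : ℝ → ℝ) (hP : Continuous P) (w : ℝ → ℝ) (hw : Continuous w)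
    (h : ∀ p, P p = p * w p) :
    (fun p : ℝ => Real.exp (P p) - (1 + P p + P p ^ 2 / 2 + P p ^ 3 / 6)) =O[nhds (0 : ℝ)]
      fun p : ℝ => p ^ 4 := by
  have ht : Tendsto P (nhds 0) (nhds 0) := by
    have := hP.tendsto 0
    rwa [h 0, zero_mul] at this
  have h1 := aux_exp.comp_tendsto ht
  refine h1.trans ?_
  refine (aux_poly (fun p => w p ^ 4) (by fun_prop)).congr_left ?_
  intro p
  simp only [Function.comp, h p]
  ring

/-- Taylor expansion of the Suris exponential force
`f_II(p) = log(N(p)/D(p))` at the origin: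
`f_II(p) = a p - (a+1)β p² + ((a+1)β² - a(10 - a²)/12) p³ + O(p⁴)`
as `p → 0`. -/
theorem suris_force_taylor
    (a β : ℝ)
    (f : ℝ → ℝ)
    (hf : ∀ p : ℝ, f p = Real.log
      (((1 + a / 4) * Real.exp (2 * p) - (1 - β) * Real.exp p
          + (1 - β - a / 4)) /
       ((1 + β - a / 4) * Real.exp (2 * p) - (1 + β) * Real.exp p
          + (1 + a / 4)))) :
    (fun p : ℝ => f p - (a * p - (a + 1) * β * p ^ 2
        + ((a + 1) * β ^ 2 - a * (10 - a ^ 2) / 12) * p ^ 3))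
      =O[nhds (0 : ℝ)] fun p : ℝ => p ^ 4 := by
  set N : ℝ → ℝ := fun p => (1 + a / 4) * Real.exp (2 * p) - (1 - β) * Real.exp p
          + (1 - β - a / 4) with hN
  set D : ℝ → ℝ := fun p => (1 + β - a / 4) * Real.exp (2 * p) - (1 + β) * Real.exp p
          + (1 + a / 4) with hD
  obtain ⟨c2, hc2⟩ : ∃ c, c = -((a + 1) * β) := ⟨_, rfl⟩
  obtain ⟨c3, hc3⟩ : ∃ c, c = (a + 1) * β ^ 2 - a * (10 - a ^ 2) / 12 := ⟨_, rfl⟩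
  set P : ℝ → ℝ := fun p => a * p + c2 * p ^ 2 + c3 * p ^ 3 with hPdef
  obtain ⟨e2, he2⟩ : ∃ c, c = c2 + a ^ 2 / 2 := ⟨_, rfl⟩
  obtain ⟨e3, he3⟩ : ∃ c, c = c3 + a * c2 + a ^ 3 / 6 := ⟨_, rfl⟩
  obtain ⟨d1, hd1⟩ : ∃ c, c = 1 + β - a / 2 := ⟨_, rfl⟩
  obtain ⟨d2, hd2⟩ : ∃ c, c = 3 / 2 + 3 * β / 2 - a / 2 := ⟨_, rfl⟩
  obtain ⟨d3, hd3⟩ : ∃ c, c = 7 / 6 + 7 * β / 6 - a / 3 := ⟨_, rfl⟩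
  have hNc : Continuous N := by fun_prop
  have hDc : Continuous D := by fun_prop
  have hPc : Continuous P := by fun_prop
  have hN0 : N 0 = 1 := by simp only [hN, mul_zero, Real.exp_zero]; ring
  have hD0 : D 0 = 1 := by simp only [hD, mul_zero, Real.exp_zero]; ring
  have hP0 : P 0 = 0 := by simp [hPdef]
  have E1 := aux_exp
  have E2 := aux_exp_comp (fun p => 2 * p) (by fun_prop) (fun _ => 2) (by fun_prop)
    (fun p => by ring)
  have EP := aux_exp_comp P hPc (fun p => a + c2 * p + c3 * p ^ 2) (by fun_prop)
    (fun p => by simp only [hPdef]; ring)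
  have R1 : (fun p => N p - (1 + (1 + a / 2 + β) * p + (3 / 2 + a / 2 + β / 2) * p ^ 2
      + (7 / 6 + a / 3 + β / 6) * p ^ 3)) =O[nhds (0 : ℝ)] fun p : ℝ => p ^ 4 := by
    refine ((E2.const_mul_left (1 + a / 4)).sub (E1.const_mul_left (1 - β))).congr_left ?_
    intro p
    simp only [hN]
    ring
  have R2 : (fun p => D p - (1 + d1 * p + d2 * p ^ 2 + d3 * p ^ 3))
      =O[nhds (0 : ℝ)] fun p : ℝ => p ^ 4 := by
    refine ((E2.const_mul_left (1 + β - a / 4)).sub (E1.const_mul_left (1 + β))).congr_left ?_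
    intro p
    simp only [hD, hd1, hd2, hd3]
    ring
  have R3 : (fun p => Real.exp (P p) - (1 + a * p + e2 * p ^ 2 + e3 * p ^ 3))
      =O[nhds (0 : ℝ)] fun p : ℝ => p ^ 4 := by
    refine (EP.add (aux_poly (fun p => (2 * a * c3 + (c2 + p * c3) ^ 2) / 2
      + (3 * a ^ 2 * (c2 + p * c3) + 3 * a * p * (c2 + p * c3) ^ 2
        + p ^ 2 * (c2 + p * c3) ^ 3) / 6) (by fun_prop))).congr_left ?_
    intro p
    simp only [he2, he3, hPdef]
    ring
  have hexp1 : (fun p => Real.exp (P p)) =O[nhds (0 : ℝ)] fun _ : ℝ => (1 : ℝ) :=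
    ((Real.continuous_exp.comp hPc).tendsto 0).isBigO_one ℝ
  have hpol1 : (fun p : ℝ => 1 + d1 * p + d2 * p ^ 2 + d3 * p ^ 3)
      =O[nhds (0 : ℝ)] fun _ : ℝ => (1 : ℝ) :=
    ((by fun_prop : Continuous fun p : ℝ => 1 + d1 * p + d2 * p ^ 2 + d3 * p ^ 3).tendsto
      0).isBigO_one ℝ
  have M1 := R2.mul hexp1
  have M2 := hpol1.mul R3
  simp only [mul_one, one_mul] at M1 M2
  have R4 : (fun p => N p - D p * Real.exp (P p)) =O[nhds (0 : ℝ)] fun p : ℝ => p ^ 4 := by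
    refine (((R1.sub M1).sub M2).sub (aux_poly (fun p => d1 * e3 + d2 * e2 + d3 * a
      + p * (d2 * e3 + d3 * e2) + p ^ 2 * d3 * e3) (by fun_prop))).congr_left ?_
    intro p
    have k1 : d1 + a = 1 + a / 2 + β := by rw [hd1]; ring
    have k2 : d2 + d1 * a + e2 = 3 / 2 + a / 2 + β / 2 := by rw [hd1, hd2, he2, hc2]; ring
    have k3 : d3 + d2 * a + d1 * e2 + e3 = 7 / 6 + a / 3 + β / 6 := by
      rw [hd1, hd2, hd3, he3, he2, hc3, hc2]; ring
    rw [← k1, ← k2, ← k3]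
    ring
  have hQc : ContinuousAt (fun p => (D p * Real.exp (P p))⁻¹) 0 := by
    refine ContinuousAt.inv₀ (by fun_prop) ?_
    rw [hD0, hP0]; simp
  have R5 : (fun p => N p / (D p * Real.exp (P p)) - 1) =O[nhds (0 : ℝ)]
      fun p : ℝ => p ^ 4 := by
    have := R4.mul (hQc.tendsto.isBigO_one ℝ)
    simp only [mul_one] at this
    refine this.congr' ?_ EventuallyEq.rfl
    filter_upwards [hDc.continuousAt.eventually_ne (by rw [hD0]; exact one_ne_zero)] with p hp
    have := Real.exp_ne_zero (P p)
    field_simp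
  have hL : (fun y : ℝ => Real.log y) =O[nhds (1 : ℝ)] fun y : ℝ => y - 1 := by
    simpa using (Real.hasDerivAt_log one_ne_zero).isBigO_sub
  have ht : Tendsto (fun p => N p / (D p * Real.exp (P p))) (nhds 0) (nhds 1) := by
    have := (hNc.tendsto 0).mul hQc.tendsto
    simpa [hN0, hD0, hP0, div_eq_mul_inv] using this
  refine ((hL.comp_tendsto ht).trans R5).congr' ?_ EventuallyEq.rfl
  filter_upwards [hDc.continuousAt.eventually_ne (by rw [hD0]; exact one_ne_zero),
    hNc.continuousAt.eventually_ne (by rw [hN0]; exact one_ne_zero)] with p hp hp'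
  have he := Real.exp_ne_zero (P p)
  have hfp : f p = Real.log (N p / D p) := hf p
  simp only [Function.comp]
  rw [hfp, ← div_div, Real.log_div (div_ne_zero hp' hp) he, Real.log_exp]
  simp only [hPdef, hc2, hc3]
  ring
end

section
/- Let a and β be real numbers and define K_II(p,q) = −a·sinh(p)·sinh(q) + 2β·(sinh(p+q) − sinh(p) − sinh(q)) + 2·(2·cosh(p)·cosh(q) − cosh(p) − cosh(q)). With Σ = p + q, Π = p q, and 𝔠 = p² + q² − a·p·q, one has, as (p,q) → (0,0): K_II(p,q) = 𝔠 + β·Π·Σ + (1/12)·𝔠² + ((10 − a²)/12)·Π² + O(‖(p,q)‖⁵); in particular, the homogeneous Taylor parts of K_II at the origin of degrees 0 and 1 vanish, the degree-2 part equals 𝔠, the degree-3 part equals β Π Σ, and the degree-4 part equals 𝔠²/12 + ((10 − a²)/12)Π². -/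
open Asymptotics Filter

theorem exp_rem : (fun x : ℝ => Real.exp x - (1 + x + x^2/2 + x^3/6 + x^4/24)) =O[nhds 0] fun x => x^5 := by
  refine IsBigO.of_bound 1 ?_
  filter_upwards [Metric.ball_mem_nhds (0:ℝ) one_pos] with x hx
  have hx' : |x| ≤ 1 := by
    have := Metric.mem_ball.1 hx
    rw [Real.dist_eq, sub_zero] at this
    exact this.le
  have h := Real.exp_bound hx' (n := 5) (by norm_num)
  simp only [Finset.sum_range_succ, Finset.sum_range_zero, Nat.factorial] at h
  norm_num at h
  rw [Real.norm_eq_abs, Real.norm_eq_abs, one_mul, abs_pow]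
  refine le_trans h ?_
  have : 0 ≤ |x|^5 := by positivity
  linarith

theorem exp_rem_neg : (fun x : ℝ => Real.exp (-x) - (1 - x + x^2/2 - x^3/6 + x^4/24)) =O[nhds 0] fun x => x^5 := by
  have ht : Tendsto (fun x : ℝ => -x) (nhds 0) (nhds 0) := by
    simpa using (continuous_neg (G := ℝ)).tendsto 0
  have h := exp_rem.comp_tendsto ht
  have h2 : ((fun x : ℝ => x^5) ∘ fun x => -x) =O[nhds 0] fun x : ℝ => x^5 := by
    refine IsBigO.of_bound 1 (Eventually.of_forall fun x => ?_)
    simp [abs_pow]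
  refine (h.trans h2).congr_left fun x => ?_
  simp only [Function.comp]
  ring

theorem sinh_rem : (fun x : ℝ => Real.sinh x - (x + x^3/6)) =O[nhds 0] fun x => x^5 := by
  refine ((exp_rem.sub exp_rem_neg).const_mul_left (1/2)).congr_left fun x => ?_
  rw [Real.sinh_eq]; ring

theorem cosh_rem : (fun x : ℝ => Real.cosh x - (1 + x^2/2 + x^4/24)) =O[nhds 0] fun x => x^5 := by
  refine ((exp_rem.add exp_rem_neg).const_mul_left (1/2)).congr_left fun x => ?_
  rw [Real.cosh_eq]; ring

theorem mul_cont {f g : ℝ × ℝ → ℝ} (hg : Continuous g)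
    (hf : f =O[nhds 0] fun z : ℝ × ℝ => ‖z‖^5) :
    (fun z => g z * f z) =O[nhds 0] fun z : ℝ × ℝ => ‖z‖^5 := by
  have h1 : g =O[nhds 0] fun _ => (1:ℝ) := (hg.tendsto 0).isBigO_one ℝ
  simpa using h1.mul hf

/-- Taylor expansion at the origin of the Suris exponential invariant
`K_II(p,q) = -a sinh p sinh q + 2β(sinh(p+q) - sinh p - sinh q)
+ 2(2 cosh p cosh q - cosh p - cosh q)`: with `Σ = p + q`, `Π = p q`,
`𝔠 = p² + q² - a p q`, one has
`K_II(p,q) = 𝔠 + β Π Σ + 𝔠²/12 + ((10 - a²)/12) Π² + O(‖(p,q)‖⁵)`;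
the displayed terms are precisely the homogeneous Taylor parts of
degrees ≤ 4 (those of degrees 0 and 1 vanish). -/
theorem suris_invariant_taylor
    (a β : ℝ)
    (K : ℝ → ℝ → ℝ)
    (hK : ∀ p q : ℝ, K p q =
      -a * Real.sinh p * Real.sinh q
        + 2 * β * (Real.sinh (p + q) - Real.sinh p - Real.sinh q)
        + 2 * (2 * Real.cosh p * Real.cosh q - Real.cosh p - Real.cosh q)) :
    (fun z : ℝ × ℝ =>
        K z.1 z.2 -
          ((z.1 ^ 2 + z.2 ^ 2 - a * (z.1 * z.2))
            + β * (z.1 * z.2) * (z.1 + z.2)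
            + (1 / 12) * (z.1 ^ 2 + z.2 ^ 2 - a * (z.1 * z.2)) ^ 2
            + ((10 - a ^ 2) / 12) * (z.1 * z.2) ^ 2))
      =O[nhds (0 : ℝ × ℝ)] fun z : ℝ × ℝ => ‖z‖ ^ 5 := by
  have e1 : (fun z : ℝ × ℝ => z.1) =O[nhds 0] fun z : ℝ × ℝ => ‖z‖ :=
    IsBigO.of_bound 1 (Eventually.of_forall fun z => by simpa using norm_fst_le z)
  have e2 : (fun z : ℝ × ℝ => z.2) =O[nhds 0] fun z : ℝ × ℝ => ‖z‖ :=
    IsBigO.of_bound 1 (Eventually.of_forall fun z => by simpa using norm_snd_le z)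
  have t1 : Tendsto (fun z : ℝ × ℝ => z.1) (nhds 0) (nhds 0) := continuous_fst.tendsto (0 : ℝ × ℝ)
  have t2 : Tendsto (fun z : ℝ × ℝ => z.2) (nhds 0) (nhds 0) := continuous_snd.tendsto (0 : ℝ × ℝ)
  have t3 : Tendsto (fun z : ℝ × ℝ => z.1 + z.2) (nhds 0) (nhds 0) := by
    simpa using t1.add t2
  have r1 := (sinh_rem.comp_tendsto t1).trans (e1.pow 5)
  have r2 := (sinh_rem.comp_tendsto t2).trans (e2.pow 5)
  have r3 := (sinh_rem.comp_tendsto t3).trans ((e1.add e2).pow 5)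
  have s1 := (cosh_rem.comp_tendsto t1).trans (e1.pow 5)
  have s2 := (cosh_rem.comp_tendsto t2).trans (e2.pow 5)
  have m1 : (fun z : ℝ × ℝ => z.1^3 * z.2^2) =O[nhds 0] fun z : ℝ × ℝ => ‖z‖^5 :=
    ((e1.pow 3).mul (e2.pow 2)).congr_right fun z => by ring
  have m2 : (fun z : ℝ × ℝ => z.1^2 * z.2^3) =O[nhds 0] fun z : ℝ × ℝ => ‖z‖^5 :=
    ((e1.pow 2).mul (e2.pow 3)).congr_right fun z => by ring
  have A1 := mul_cont (g := fun z => -a * Real.sinh z.1 - 2 * β) (by fun_prop) r2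
  have A2 := mul_cont (g := fun z => -a * (z.2 + z.2^3/6) - 2 * β) (by fun_prop) r1
  have A3 := mul_cont (g := fun _ => 2 * β) (by fun_prop) r3
  have A4 := mul_cont (g := fun z => 4 * Real.cosh z.1 - 2) (by fun_prop) s2
  have A5 := mul_cont (g := fun z => 4 * (1 + z.2^2/2 + z.2^4/24) - 2) (by fun_prop) s1
  have A6 := mul_cont (g := fun z => -a * z.2 / 36 + z.1 / 12 + z.1 * z.2^2 / 144) (by fun_prop) m1
  have A7 := mul_cont (g := fun z => z.2 / 12) (by fun_prop) m2
  refine ((((((A1.add A2).add A3).add A4).add A5).add A6).add A7).congr_left fun z => ?_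
  simp only [Function.comp, hK]
  ring
end
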